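/- arXiv:2401.14958 — 2 statements merged into one kernel-verified Lean document; each statement's English description precedes it below -/
import Mathlib

section
/- Let Q be a strictly sign-coherent ice quiver on n mutable vertices whose mutable subquiver is a fork with point of return r. Then there exists a mutation sequence of length at most n+2 taking Q to an ice quiver whose mutable subquiver is a fork, whose point of return is a green vertex, which has at most one other green vertex, and which has at least n-2 red vertices. -/
open Matrix

section QuiverDefs

variable {V W : Type*}

/-- Mutation of an exchange matrix at the vertex `k`. -/
def mutB [DecidableEq V] (B : Matrix V V ℤ) (k : V) : Matrix V V ℤ :=
  Matrix.of fun i j =>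
    if i = k ∨ j = k then -B i j else B i j + (B i k).sign * max (B i k * B k j) 0

/-- Mutation of the `C`-matrix of an extended exchange matrix `[B | C]` at the vertex `k`. -/
def mutC [DecidableEq V] (B : Matrix V V ℤ) (C : Matrix V W ℤ) (k : V) : Matrix V W ℤ :=
  Matrix.of fun i j =>
    if i = k then -C i j else C i j + (B i k).sign * max (B i k * C k j) 0

/-- One mutation step on an extended exchange matrix `[B | C]`, regarded as a pair `(B, C)`. -/
def mutPair [DecidableEq V] (P : Matrix V V ℤ × Matrix V W ℤ) (k : V) :
    Matrix V V ℤ × Matrix V W ℤ :=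
  (mutB P.1 k, mutC P.1 P.2 k)

/-- Iterated mutation of an extended exchange matrix along a list of mutable vertices. -/
def mutSeqPair [DecidableEq V] (P : Matrix V V ℤ × Matrix V W ℤ) (w : List V) :
    Matrix V V ℤ × Matrix V W ℤ :=
  w.foldl mutPair P

/-- Iterated mutation of an exchange matrix along a list of vertices. -/
def mutSeqB [DecidableEq V] (B : Matrix V V ℤ) (w : List V) : Matrix V V ℤ :=
  w.foldl mutB B

/-- A quiver is abundant if there are at least two arrows between any two distinct vertices. -/
def QAbundant (B : Matrix V V ℤ) : Prop := ∀ i j, i ≠ j → 2 ≤ |B i j|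

/-- There is a directed cycle of the quiver `B` all of whose vertices lie in `S`. -/
def HasCycleIn (B : Matrix V V ℤ) (S : Set V) : Prop :=
  ∃ (x : V) (l : List V), x ∈ S ∧ (∀ y ∈ l, y ∈ S) ∧
    List.Chain (fun i j => 0 < B i j) x (l ++ [x])

/-- A quiver is acyclic if it has no directed cycle. -/
def QAcyclic (B : Matrix V V ℤ) : Prop := ¬ HasCycleIn B Set.univ

/-- The vertex `x` is a source: all arrows at `x` point away from `x`. -/
def QSource (B : Matrix V V ℤ) (x : V) : Prop := ∀ j, 0 ≤ B x j

/-- The vertex `x` is a sink: all arrows at `x` point into `x`. -/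
def QSink (B : Matrix V V ℤ) (x : V) : Prop := ∀ j, B x j ≤ 0

/-- `B` is a fork with point of return `r`: it is abundant, not acyclic, the full subquiver
obtained by deleting `r` is acyclic, and for all `i` with `i → r` and `j` with `r → j` one has
`b_{ji} > b_{ir}` and `b_{ji} > b_{rj}`. -/
def QFork (B : Matrix V V ℤ) (r : V) : Prop :=
  QAbundant B ∧ ¬ QAcyclic B ∧ ¬ HasCycleIn B {x | x ≠ r} ∧
    ∀ i j, 0 < B i r → 0 < B r j → B i r < B j i ∧ B r j < B j i

/-- The mutable vertex `i` is green: its `c`-vector is nonzero with all entries `≥ 0`. -/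
def QGreen (C : Matrix V W ℤ) (i : V) : Prop := (∀ j, 0 ≤ C i j) ∧ C i ≠ 0

/-- The mutable vertex `i` is red: its `c`-vector is nonzero with all entries `≤ 0`. -/
def QRed (C : Matrix V W ℤ) (i : V) : Prop := (∀ j, C i j ≤ 0) ∧ C i ≠ 0

/-- The mutable vertex `i` is blue: its `c`-vector is zero. -/
def QBlue (C : Matrix V W ℤ) (i : V) : Prop := C i = 0

/-- `i` has the same color (red/green/blue) with respect to `C` and to `C'`. -/
def SameColorQ (C C' : Matrix V W ℤ) (i : V) : Prop :=
  (QRed C i ↔ QRed C' i) ∧ (QGreen C i ↔ QGreen C' i) ∧ (QBlue C i ↔ QBlue C' i)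

/-- The `c`-vectors of `i` and `j` have the same sign (`sgn(c_i) = sgn(c_j)`). -/
def SameSignQ (C : Matrix V W ℤ) (i j : V) : Prop :=
  (QGreen C i ∧ QGreen C j) ∨ (QRed C i ∧ QRed C j)

/-- The `c`-vectors of `i` and `j` have opposite signs (`sgn(c_i) = -sgn(c_j)`). -/
def OppSignQ (C : Matrix V W ℤ) (i j : V) : Prop :=
  (QGreen C i ∧ QRed C j) ∨ (QRed C i ∧ QGreen C j)

/-- An ice quiver is uniformly sign-coherent if after every mutation sequence every mutable
vertex is red, green, or blue, and not every mutable vertex of the initial quiver is blue. -/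
def USC [DecidableEq V] (P : Matrix V V ℤ × Matrix V W ℤ) : Prop :=
  (∀ (w : List V) (i : V),
      QRed (mutSeqPair P w).2 i ∨ QGreen (mutSeqPair P w).2 i ∨ QBlue (mutSeqPair P w).2 i) ∧
    ¬ ∀ i, QBlue P.2 i

/-- An ice quiver is strictly sign-coherent if after every mutation sequence every mutable
vertex is red or green. -/
def SSC [DecidableEq V] (P : Matrix V V ℤ × Matrix V W ℤ) : Prop :=
  ∀ (w : List V) (i : V), QRed (mutSeqPair P w).2 i ∨ QGreen (mutSeqPair P w).2 i

/-- The four sign conditions at the distinguished vertex `r`: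
(1) every mutable vertex is red or green;
(2) if every entry of `b_{rj}·c_j` is `≥ 0` for some `j ≠ r`, then `sgn(c_j) = sgn(c_r)` or
    `sgn(c_j)·c_j ≥ sgn(c_r)·c_r` entrywise (i.e. `|c_r| ≤ |c_j|` entrywise);
(3) if every entry of `b_{rj}·c_j` is `≤ 0` for some `j ≠ r`, then `sgn(c_j) = -sgn(c_r)`;
(4) if every entry of `b_{ij}·c_j` is `≥ 0` for distinct `i, j` both `≠ r`,
    then `sgn(c_i) = sgn(c_j)`. -/
def FourConds (Bw : Matrix V V ℤ) (Cw : Matrix V W ℤ) (r : V) : Prop :=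
  (∀ i, QRed Cw i ∨ QGreen Cw i) ∧
  (∀ j, j ≠ r → (∀ t, 0 ≤ Bw r j * Cw j t) →
    (SameSignQ Cw j r ∨ ∀ t, |Cw r t| ≤ |Cw j t|)) ∧
  (∀ j, j ≠ r → (∀ t, Bw r j * Cw j t ≤ 0) → OppSignQ Cw j r) ∧
  (∀ i j, i ≠ j → i ≠ r → j ≠ r → (∀ t, 0 ≤ Bw i j * Cw j t) → SameSignQ Cw i j)

end QuiverDefs


section Basics

variable {V : Type*} [DecidableEq V]

/-- Mutation of a scalar weight attached to the vertices. -/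
def mc (B : Matrix V V ℤ) (c : V → ℤ) (k : V) : V → ℤ := fun x =>
  if x = k then -c x else c x + (B x k).sign * max (B x k * c k) 0

/-- One step on a pair. -/
def mstep (P : Matrix V V ℤ × (V → ℤ)) (k : V) : Matrix V V ℤ × (V → ℤ) :=
  (mutB P.1 k, mc P.1 P.2 k)

/-- Iterated steps. -/
def mrun (P : Matrix V V ℤ × (V → ℤ)) (w : List V) : Matrix V V ℤ × (V → ℤ) :=
  w.foldl mstep P

theorem mrun_cons (B : Matrix V V ℤ) (c : V → ℤ) (k : V) (w : List V) :
    mrun (B, c) (k :: w) = mrun (mutB B k, mc B c k) w := rfl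

theorem mrun_append (P : Matrix V V ℤ × (V → ℤ)) (u w : List V) :
    mrun P (u ++ w) = mrun (mrun P u) w := by
  simp [mrun, List.foldl_append]

theorem mc_self (B : Matrix V V ℤ) (c : V → ℤ) (k : V) : mc B c k k = -c k := by
  simp [mc]

theorem mc_pp {B : Matrix V V ℤ} {c : V → ℤ} {k x : V} (hx : x ≠ k) (hc : 0 < c k)
    (hb : 0 < B x k) : mc B c k x = c x + B x k * c k := by
  have h := mul_pos hb hc
  simp [mc, hx, Int.sign_eq_one_of_pos hb, max_eq_left h.le]

theorem mc_pn {B : Matrix V V ℤ} {c : V → ℤ} {k x : V} (hx : x ≠ k) (hc : 0 < c k)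
    (hb : B x k ≤ 0) : mc B c k x = c x := by
  have h := mul_nonpos_of_nonpos_of_nonneg hb hc.le
  simp [mc, hx, max_eq_right h]

theorem mc_nn {B : Matrix V V ℤ} {c : V → ℤ} {k x : V} (hx : x ≠ k) (hc : c k < 0)
    (hb : B x k < 0) : mc B c k x = c x - B x k * c k := by
  have h := mul_pos_of_neg_of_neg hb hc
  simp [mc, hx, Int.sign_eq_neg_one_of_neg hb, max_eq_left h.le]
  ring

theorem mc_np {B : Matrix V V ℤ} {c : V → ℤ} {k x : V} (hx : x ≠ k) (hc : c k < 0)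
    (hb : 0 ≤ B x k) : mc B c k x = c x := by
  have h := mul_nonpos_of_nonneg_of_nonpos hb hc.le
  simp [mc, hx, max_eq_right h]

theorem mc_ge {B : Matrix V V ℤ} {c : V → ℤ} {k x : V} (hx : x ≠ k) (hc : 0 < c k) :
    c x ≤ mc B c k x := by
  rcases lt_or_ge 0 (B x k) with h | h
  · rw [mc_pp hx hc h]; nlinarith
  · rw [mc_pn hx hc h]

theorem mc_le {B : Matrix V V ℤ} {c : V → ℤ} {k x : V} (hx : x ≠ k) (hc : c k < 0) :
    mc B c k x ≤ c x := by
  rcases lt_or_ge (B x k) 0 with h | h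
  · rw [mc_nn hx hc h]; nlinarith
  · rw [mc_np hx hc h]

theorem mutB_l (B : Matrix V V ℤ) (k j : V) : mutB B k k j = -B k j := by simp [mutB]
theorem mutB_r (B : Matrix V V ℤ) (k i : V) : mutB B k i k = -B i k := by simp [mutB]

theorem mutB_pp {B : Matrix V V ℤ} {k x y : V} (hx : x ≠ k) (hy : y ≠ k)
    (h1 : 0 < B x k) (h2 : 0 < B k y) : mutB B k x y = B x y + B x k * B k y := by
  have h := mul_pos h1 h2
  simp [mutB, hx, hy, Int.sign_eq_one_of_pos h1, max_eq_left h.le]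

theorem mutB_nn {B : Matrix V V ℤ} {k x y : V} (hx : x ≠ k) (hy : y ≠ k)
    (h1 : B x k < 0) (h2 : B k y < 0) : mutB B k x y = B x y - B x k * B k y := by
  have h := mul_pos_of_neg_of_neg h1 h2
  simp [mutB, hx, hy, Int.sign_eq_neg_one_of_neg h1, max_eq_left h.le]
  ring

theorem mutB_np {B : Matrix V V ℤ} {k x y : V} (hx : x ≠ k) (hy : y ≠ k)
    (h1 : B x k ≤ 0) (h2 : 0 ≤ B k y) : mutB B k x y = B x y := by
  have h := mul_nonpos_of_nonpos_of_nonneg h1 h2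
  simp [mutB, hx, hy, max_eq_right h]

theorem mutB_pn {B : Matrix V V ℤ} {k x y : V} (hx : x ≠ k) (hy : y ≠ k)
    (h1 : 0 ≤ B x k) (h2 : B k y ≤ 0) : mutB B k x y = B x y := by
  have h := mul_nonpos_of_nonneg_of_nonpos h1 h2
  simp [mutB, hx, hy, max_eq_right h]

theorem mutB_skew {B : Matrix V V ℤ} (hs : ∀ i j, B j i = -B i j) (k i j : V) :
    mutB B k j i = -mutB B k i j := by
  by_cases hi : i = k
  · subst hi; rw [mutB_l, mutB_r, hs]
  by_cases hj : j = k
  · subst hj; rw [mutB_l, mutB_r, hs]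
  have a := hs k i
  have b := hs k j
  have d := hs i j
  rcases lt_trichotomy (B i k) 0 with h1 | h1 | h1 <;>
  rcases lt_trichotomy (B k j) 0 with h2 | h2 | h2
  · rw [mutB_nn hi hj h1 h2, mutB_pp hj hi (by linarith) (by linarith), a, b, d]; ring
  all_goals first
    | (rw [mutB_pp hi hj h1 h2, mutB_nn hj hi (by linarith) (by linarith), a, b, d]; ring)
    | (rw [mutB_np hi hj (by linarith) (by linarith), mutB_np hj hi (by linarith) (by linarith), d])
    | (rw [mutB_np hi hj (by linarith) (by linarith), mutB_pn hj hi (by linarith) (by linarith), d])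
    | (rw [mutB_pn hi hj (by linarith) (by linarith), mutB_np hj hi (by linarith) (by linarith), d])
    | (rw [mutB_pn hi hj (by linarith) (by linarith), mutB_pn hj hi (by linarith) (by linarith), d])

/-- A fork with point of return `p`, together with an acyclic order off `p`. -/
structure FO (B : Matrix V V ℤ) (p : V) (o : V → ℤ) : Prop where
  skew : ∀ i j, B j i = -B i j
  inj : ∀ x y, o x = o y → x = y
  top : ∀ x, x ≠ p → o x < o p
  ord : ∀ x y, x ≠ p → y ≠ p → o x < o y → 2 ≤ B x y
  por : ∀ x, x ≠ p → 2 ≤ B p x ∨ 2 ≤ B x p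
  wt : ∀ x y, 0 < B p x → 0 < B y p → B p x < B x y ∧ B y p < B x y
  lo : ∃ x, 0 < B p x
  hi : ∃ y, 0 < B y p

theorem FO.self {B : Matrix V V ℤ} {p : V} {o : V → ℤ} (h : FO B p o) (x : V) : B x x = 0 := by
  have := h.skew x x; omega

theorem FO.ne {B : Matrix V V ℤ} {p : V} {o : V → ℤ} (h : FO B p o) {x y : V} (hh : 0 < B x y) :
    x ≠ y := by
  rintro rfl; have := h.self x; omega

theorem FO.lt {B : Matrix V V ℤ} {p : V} {o : V → ℤ} (h : FO B p o) {x y : V} (hx : x ≠ p)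
    (hy : y ≠ p) (hh : 0 < B x y) : o x < o y := by
  by_contra hc
  have h1 : o y ≠ o x := fun e => h.ne hh (h.inj _ _ e).symm
  have := h.ord y x hy hx (by omega)
  have := h.skew x y
  omega

/-- Mutation at a vertex with an arrow to the point of return. -/
theorem FO.mutHi {B : Matrix V V ℤ} {p : V} {o : V → ℤ} (h : FO B p o) {k : V} (hk : k ≠ p)
    (hkp : 0 < B k p) {T : ℤ} (hT : ∀ x, o x < T) :
    FO (mutB B k) k (Function.update o k T) := by
  have hpk : p ≠ k := hk.symm
  have s1 := h.skew k p
  have hkp2 : 2 ≤ B k p := by rcases h.por k hk with a | a <;> omega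
  have upd : ∀ x, x ≠ k → Function.update o k T x = o x := fun x hx => by simp [hx]
  have updk : Function.update o k T k = T := by simp
  have key : ∀ x, x ≠ k → x ≠ p → o x < o k → 2 ≤ mutB B k x p ∧
      B x k < mutB B k x p ∧ B k p < mutB B k x p := by
    intro x hx hxp hl
    have h1 := h.ord x k hxp hk hl
    rw [mutB_pp hx hpk (by omega) hkp]
    have s2 := h.skew x p
    rcases h.por x hxp with a | a
    · obtain ⟨w1, w2⟩ := h.wt x k (by omega) hkp
      refine ⟨?_, ?_, ?_⟩ <;> nlinarith
    · refine ⟨?_, ?_, ?_⟩ <;> nlinarith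
  refine ⟨mutB_skew h.skew k, ?_, ?_, ?_, ?_, ?_, ?_, ?_⟩
  · intro x y e
    by_cases hx : x = k <;> by_cases hy : y = k
    · rw [hx, hy]
    · rw [hx, updk, upd y hy] at e; have := hT y; omega
    · rw [hy, updk, upd x hx] at e; have := hT x; omega
    · rw [upd x hx, upd y hy] at e; exact h.inj _ _ e
  · intro x hx; rw [upd x hx, updk]; exact hT x
  · intro x y hx hy hl
    rw [upd x hx, upd y hy] at hl
    have hxp : x ≠ p := by
      rintro rfl
      by_cases e : y = x
      · subst e; omega
      · have := h.top y e; omega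
    by_cases hyp : y = p
    · subst hyp
      rcases lt_trichotomy (o x) (o k) with a | a | a
      · exact (key x hx hxp a).1
      · exact absurd (h.inj _ _ a) hx
      · have h1 := h.ord k x hk hxp a
        have s2 := h.skew k x
        have s3 := h.skew x y
        rw [mutB_np hx hy (by omega) (by omega)]
        rcases h.por x hxp with b | b
        · have := h.wt x k (by omega) hkp; omega
        · exact b
    · have h1 := h.ord x y hxp hyp hl
      have s2 := h.skew k x
      have s3 := h.skew k y
      rcases lt_trichotomy (o x) (o k) with a | a | a
      · have h2 := h.ord x k hxp hk a
        rcases lt_trichotomy (o y) (o k) with b | b | b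
        · have h3 := h.ord y k hyp hk b
          rw [mutB_pn hx hy (by omega) (by omega)]; exact h1
        · exact absurd (h.inj _ _ b) hy
        · have h3 := h.ord k y hk hyp b
          rw [mutB_pp hx hy (by omega) (by omega)]; nlinarith
      · exact absurd (h.inj _ _ a) hx
      · have h2 := h.ord k x hk hxp a
        have h3 := h.ord k y hk hyp (by omega)
        rw [mutB_np hx hy (by omega) (by omega)]; exact h1
  · intro x hx
    rw [mutB_l, mutB_r]
    have s2 := h.skew k x
    by_cases hxp : x = p
    · subst hxp; omega
    · rcases lt_trichotomy (o x) (o k) with a | a | a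
      · have h2 := h.ord x k hxp hk a; omega
      · exact absurd (h.inj _ _ a) hx
      · have h2 := h.ord k x hk hxp a; omega
  · intro x y h1 h2
    rw [mutB_l] at h1
    rw [mutB_r] at h2
    have s2 := h.skew k x
    have s3 := h.skew k y
    rw [mutB_l, mutB_r]
    have hx : x ≠ k := h.ne (x := x) (by omega)
    have hy : y ≠ k := (h.ne (x := k) (y := y) (by omega)).symm
    have hxp : x ≠ p := by rintro rfl; omega
    have hxk := h.lt hxp hk (by omega)
    by_cases hyp : y = p
    · subst hyp
      have := key x hx hxp hxk
      omega
    · have hky := h.lt hk hyp (by omega)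
      have := h.ord x y hxp hyp (by omega)
      rw [mutB_pp hx hy (by omega) (by omega)]
      constructor <;> nlinarith
  · obtain ⟨x, hx⟩ := h.lo
    have := h.wt x k hx hkp
    refine ⟨x, ?_⟩
    rw [mutB_l]
    have s2 := h.skew k x
    omega
  · exact ⟨p, by rw [mutB_r]; omega⟩

/-- Mutation at a vertex with an arrow from the point of return. -/
theorem FO.mutLo {B : Matrix V V ℤ} {p : V} {o : V → ℤ} (h : FO B p o) {k : V} 
    (hkp : 0 < B p k) {T b : ℤ} (hT : ∀ x, o x < T) (hb : ∀ x, b < o x) :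
    FO (mutB B k) k (Function.update (Function.update o p b) k T) := by
  have hpk : p ≠ k := h.ne hkp
  have hk := hpk.symm
  have s1 := h.skew k p
  have hkp2 : 2 ≤ B p k := by rcases h.por k hk with a | a <;> omega
  set o' := Function.update (Function.update o p b) k T with ho'
  have upd : ∀ x, x ≠ k → x ≠ p → o' x = o x := fun x hx hp => by simp [ho', hx, hp]
  have updk : o' k = T := by simp [ho']
  have updp : o' p = b := by simp [ho', hpk]
  have key : ∀ y, y ≠ k → y ≠ p → o k < o y → 2 ≤ mutB B k p y ∧
      B k y < mutB B k p y ∧ B p k < mutB B k p y := by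
    intro x hx hxp hl
    have h1 := h.ord k x hk hxp hl
    rw [mutB_pp hpk hx (by omega) (by omega)]
    have s2 := h.skew x p
    rcases h.por x hxp with a | a
    · refine ⟨?_, ?_, ?_⟩ <;> nlinarith
    · obtain ⟨w1, w2⟩ := h.wt k x (by omega) (by omega)
      refine ⟨?_, ?_, ?_⟩ <;> nlinarith
  have hbT : b < T := lt_trans (hb p) (hT p)
  refine ⟨mutB_skew h.skew k, ?_, ?_, ?_, ?_, ?_, ?_, ?_⟩
  · intro x y e
    have h1 := hb x
    have h2 := hb y
    have h3 := hT x
    have h4 := hT y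
    by_cases hx : x = k <;> by_cases hy : y = k
    · rw [hx, hy]
    · by_cases hyp : y = p
      · rw [hx, hyp, updk, updp] at e; omega
      · rw [hx, updk, upd y hy hyp] at e; omega
    · by_cases hxp : x = p
      · rw [hy, hxp, updk, updp] at e; omega
      · rw [hy, updk, upd x hx hxp] at e; omega
    · by_cases hxp : x = p <;> by_cases hyp : y = p
      · rw [hxp, hyp]
      · rw [hxp, updp, upd y hy hyp] at e; omega
      · rw [hyp, updp, upd x hx hxp] at e; omega
      · rw [upd x hx hxp, upd y hy hyp] at e; exact h.inj _ _ e
  · intro x hx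
    by_cases hxp : x = p
    · rw [hxp, updp, updk]; exact hbT
    · rw [upd x hx hxp, updk]; exact hT x
  · intro x y hx hy hl
    have hyp : y ≠ p := by
      rintro rfl
      rw [updp] at hl
      by_cases hxp : x = y
      · rw [hxp, updp] at hl; omega
      · rw [upd x hx hxp] at hl; have := hb x; omega
    rw [upd y hy hyp] at hl
    by_cases hxp : x = p
    · subst hxp
      rcases lt_trichotomy (o y) (o k) with a | a | a
      · have h1 := h.ord y k hyp hk a
        have s2 := h.skew k y
        have s3 := h.skew x y
        rw [mutB_pn hx hy (by omega) (by omega)]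
        rcases h.por y hyp with b | b
        · exact b
        · have := h.wt k y (by omega) (by omega); omega
      · exact absurd (h.inj _ _ a) hy
      · exact (key y hy hyp a).1
    · rw [upd x hx hxp] at hl
      have h1 := h.ord x y hxp hyp hl
      have s2 := h.skew k x
      have s3 := h.skew k y
      rcases lt_trichotomy (o x) (o k) with a | a | a
      · have h2 := h.ord x k hxp hk a
        rcases lt_trichotomy (o y) (o k) with b | b | b
        · have h3 := h.ord y k hyp hk b
          rw [mutB_pn hx hy (by omega) (by omega)]; exact h1
        · exact absurd (h.inj _ _ b) hy
        · have h3 := h.ord k y hk hyp b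
          rw [mutB_pp hx hy (by omega) (by omega)]; nlinarith
      · exact absurd (h.inj _ _ a) hx
      · have h2 := h.ord k x hk hxp a
        have h3 := h.ord k y hk hyp (by omega)
        rw [mutB_np hx hy (by omega) (by omega)]; exact h1
  · intro x hx
    rw [mutB_l, mutB_r]
    have s2 := h.skew k x
    by_cases hxp : x = p
    · subst hxp; omega
    · rcases lt_trichotomy (o x) (o k) with a | a | a
      · have h2 := h.ord x k hxp hk a; omega
      · exact absurd (h.inj _ _ a) hx
      · have h2 := h.ord k x hk hxp a; omega
  · intro x y h1 h2
    rw [mutB_l] at h1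
    rw [mutB_r] at h2
    have s2 := h.skew k x
    have s3 := h.skew k y
    rw [mutB_l, mutB_r]
    have hx : x ≠ k := h.ne (x := x) (by omega)
    have hy : y ≠ k := (h.ne (x := k) (y := y) (by omega)).symm
    have hyp : y ≠ p := by rintro rfl; omega
    have hky := h.lt hk hyp (by omega)
    by_cases hxp : x = p
    · subst hxp
      have := key y hy hyp hky
      omega
    · have hxk := h.lt hxp hk (by omega)
      have := h.ord x y hxp hyp (by omega)
      rw [mutB_pp hx hy (by omega) (by omega)]
      constructor <;> nlinarith
  · exact ⟨p, by rw [mutB_l]; omega⟩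
  · obtain ⟨y, hy⟩ := h.hi
    have := h.wt k y hkp hy
    exact ⟨y, by rw [mutB_r]; have := h.skew k y; omega⟩

end Basics

section Forks

variable {V : Type*} [DecidableEq V]

theorem chain_lt {B : Matrix V V ℤ} {S : Set V} {o : V → ℤ}
    (h : ∀ i j, i ∈ S → j ∈ S → 0 < B i j → o i < o j) (y : V) (hy : y ∈ S) :
    ∀ (l : List V) (x : V), x ∈ S → (∀ z ∈ l, z ∈ S) →
      List.Chain (fun i j => 0 < B i j) x (l ++ [y]) → o x < o y := by
  intro l
  induction l with
  | nil =>
    intro x hx _ hc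
    have hc := (List.isChain_cons_cons.1 hc).1
    exact h x y hx hy hc
  | cons a l ih =>
    intro x hx hl hc
    rw [List.cons_append] at hc
    have hc' := List.isChain_cons_cons.1 hc
    have h1 := h x a hx (hl a (by simp)) hc'.1
    have h2 := ih a (hl a (by simp)) (fun z hz => hl z (by simp [hz])) hc'.2
    omega

theorem no_cycle {B : Matrix V V ℤ} {S : Set V} (o : V → ℤ)
    (h : ∀ i j, i ∈ S → j ∈ S → 0 < B i j → o i < o j) : ¬ HasCycleIn B S := by
  rintro ⟨x, l, hx, hl, hc⟩
  exact lt_irrefl _ (chain_lt h x hx l x hx hl hc)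

theorem FO.qfork {B : Matrix V V ℤ} {p : V} {o : V → ℤ} (h : FO B p o) : QFork B p := by
  refine ⟨?_, ?_, ?_, ?_⟩
  · intro i j hij
    have hs := h.skew i j
    have : 2 ≤ B i j ∨ 2 ≤ B j i := by
      by_cases hi : i = p
      · subst hi; exact h.por j hij.symm
      by_cases hj : j = p
      · subst hj; exact (h.por i hij).symm
      rcases lt_trichotomy (o i) (o j) with a | a | a
      · exact Or.inl (h.ord _ _ hi hj a)
      · exact absurd (h.inj _ _ a) hij
      · exact Or.inr (h.ord _ _ hj hi a)
    rcases this with a | a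
    · exact le_trans a (le_abs_self _)
    · exact le_trans (by omega) (neg_le_abs (B i j))
  · intro hac
    obtain ⟨x, hx⟩ := h.lo
    obtain ⟨y, hy⟩ := h.hi
    have := h.wt x y hx hy
    refine hac ⟨p, [x, y], trivial, fun _ _ => trivial, ?_⟩
    refine List.isChain_cons_cons.2 ⟨hx, List.isChain_cons_cons.2 ⟨by omega, ?_⟩⟩
    simpa using hy
  · exact no_cycle o fun i j hi hj hh => h.lt hi hj hh
  · intro i j h1 h2
    exact (h.wt j i h2 h1).symm

theorem QFork.exists_FO [Fintype V] {B : Matrix V V ℤ} (hs : ∀ i j, B j i = -B i j) {r : V}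
    (h : QFork B r) : ∃ o, FO B r o := by
  classical
  obtain ⟨hab, hcyc, hac, hw⟩ := h
  have arc : ∀ i j, i ≠ j → 2 ≤ B i j ∨ 2 ≤ B j i := by
    intro i j hij
    have h1 := hab i j hij
    have := hs i j
    rcases abs_cases (B i j) with a | a <;> omega
  have self : ∀ i, B i i = 0 := fun i => by have := hs i i; omega
  have trans : ∀ z x y, z ≠ r → x ≠ r → y ≠ r → 0 < B z x → 0 < B x y → 0 < B z y := by
    intro z x y hz hx hy h1 h2
    have hzy : z ≠ y := by rintro rfl; have := hs z x; omega
    rcases arc z y hzy with a | a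
    · omega
    · exfalso
      refine hac ⟨x, [y, z], hx, ?_, ?_⟩
      · intro w hw; simp at hw; rcases hw with rfl | rfl <;> assumption
      · refine List.isChain_cons_cons.2 ⟨h2, List.isChain_cons_cons.2 ⟨by omega, ?_⟩⟩
        simpa using h1
  let P : V → Finset V := fun x => Finset.univ.filter fun z => z ≠ r ∧ 0 < B z x
  have hP : ∀ x y, x ≠ r → y ≠ r → 0 < B x y → (P x).card < (P y).card := by
    intro x y hx hy hh
    apply Finset.card_lt_card
    rw [Finset.ssubset_iff_of_subset]
    · exact ⟨x, by simp [P, hx, hh], by simp [P, self]⟩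
    · intro z hz
      simp only [P, Finset.mem_filter, Finset.mem_univ, true_and] at hz ⊢
      exact ⟨hz.1, trans z x y hz.1 hx hy hz.2 hh⟩
  let o : V → ℤ := fun x => if x = r then (Fintype.card V : ℤ) + 1 else (P x).card
  have or : o r = (Fintype.card V : ℤ) + 1 := by simp [o]
  have ox : ∀ x, x ≠ r → o x = (P x).card := fun x hx => by simp [o, hx]
  have olt : ∀ x y, x ≠ r → y ≠ r → 0 < B x y → o x < o y := by
    intro x y hx hy hh
    rw [ox x hx, ox y hy]; exact_mod_cast hP x y hx hy hh
  have otop : ∀ x, x ≠ r → o x < o r := by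
    intro x hx
    rw [or, ox x hx]
    have := Finset.card_le_univ (P x)
    omega
  refine ⟨o, hs, ?_, otop, ?_, ?_, ?_, ?_, ?_⟩
  · intro x y e
    by_contra hxy
    by_cases hx : x = r
    · subst hx; have := otop y (Ne.symm hxy); omega
    by_cases hy : y = r
    · subst hy; have := otop x hxy; omega
    rcases arc x y hxy with a | a
    · have := olt x y hx hy (by omega); omega
    · have := olt y x hy hx (by omega); omega
  · intro x y hx hy hl
    rcases arc x y (by rintro rfl; omega) with a | a
    · exact a
    · have := olt y x hy hx (by omega); omega
  · intro x hx
    exact arc r x hx.symm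
  · intro x y h1 h2
    exact (hw y x h2 h1).symm
  · by_contra hc
    push Not at hc
    apply hcyc
    refine no_cycle o fun i j _ _ hh => ?_
    have hi : i ≠ r := by rintro rfl; have := hc j; omega
    by_cases hj : j = r
    · rw [hj]; exact otop i hi
    · exact olt i j hi hj hh
  · by_contra hc
    push Not at hc
    apply hcyc
    refine no_cycle (fun x => if x = r then -1 else o x) fun i j _ _ hh => ?_
    have hj : j ≠ r := by rintro rfl; have := hc i; omega
    by_cases hi : i = r
    · simp [hi, hj, ox]; omega
    · simp only [hi, hj, if_false]; exact olt i j hi hj hh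

theorem exists_above [Fintype V] (o : V → ℤ) : ∃ T, ∀ x, o x < T := by
  obtain ⟨T, hT⟩ := (Set.finite_range o).bddAbove
  exact ⟨T + 1, fun x => by have := hT ⟨x, rfl⟩; omega⟩

theorem exists_below [Fintype V] (o : V → ℤ) : ∃ b, ∀ x, b < o x := by
  obtain ⟨T, hT⟩ := (Set.finite_range o).bddBelow
  exact ⟨T - 1, fun x => by have := hT ⟨x, rfl⟩; omega⟩

theorem exists_sorted (o : V → ℤ) (inj : ∀ x y, o x = o y → x = y) (S : Finset V) :
    ∃ l : List V, (∀ x, x ∈ l ↔ x ∈ S) ∧ l.Pairwise (fun x y => o x < o y) ∧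
      l.length = S.card := by
  induction S using Finset.induction_on_max_value o with
  | empty => exact ⟨[], by simp⟩
  | insert a s ha hle ih =>
    obtain ⟨l, h1, h2, h3⟩ := ih
    refine ⟨l ++ [a], ?_, ?_, ?_⟩
    · intro x; simp [h1, or_comm]
    · rw [List.pairwise_append]
      refine ⟨h2, by simp, ?_⟩
      intro x hx y hy
      simp at hy
      subst hy
      have hx' := (h1 x).1 hx
      have := hle x hx'
      have : o x ≠ o y := fun e => ha (inj _ _ e ▸ hx')
      omega
    · simp [h3, ha]

end Forks

section Phases

variable {V : Type*} [DecidableEq V] [Fintype V]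

theorem FO.arcTo {B : Matrix V V ℤ} {p : V} {o : V → ℤ} (h : FO B p o) {k : V} (hk : k ≠ p)
    (hkp : 0 < B k p) {x : V} (hx : o k < o x) : 2 ≤ B k x := by
  by_cases e : x = p
  · subst e; have := h.skew k x; rcases h.por k hk with a | a <;> omega
  · exact h.ord k x hk e hx

theorem FO.arcFrom {B : Matrix V V ℤ} {p : V} {o : V → ℤ} (h : FO B p o) {k : V} (hk : k ≠ p)
    {x : V} (hx : o x < o k) : 2 ≤ B x k := by
  by_cases e : x = p
  · subst e; have := h.top k hk; omega
  · exact h.ord x k e hk hx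

theorem phase1a : ∀ (K : List V) (B : Matrix V V ℤ) (c : V → ℤ) (p : V) (o : V → ℤ)
    (O : V → Prop), FO B p o → K.Pairwise (fun x y => o x < o y) →
    (∀ k, K.head? = some k → k ≠ p) → (∀ k ∈ K, 0 < c k) → (∀ k ∈ K, k ≠ p → 0 < B k p) →
    (∀ x, O x → ∀ k ∈ K, o k < o x) → (∀ x, O x → x ≠ p → 0 < B x p) →
    ∃ B' c' p' o', mrun (B, c) K = (B', c') ∧ FO B' p' o' ∧ (K = [] → p' = p) ∧
      (K ≠ [] → p' ∈ K) ∧ (∀ x, x ∉ K → o' x = o x) ∧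
      (∀ k ∈ K, ∀ x, x ∉ K → o' x < o' k) ∧ (∀ k ∈ K, c' k < 0) ∧
      (∀ x, x ∉ K → c x ≤ c' x) ∧
      (∀ x, x ∉ K → ∀ g ∈ K, o x < o g → c x + B x g * c g ≤ c' x) ∧
      (∀ x, O x → c' x = c x) ∧ (∀ x y, O x → O y → B' x y = B x y) ∧
      (∀ x, O x → x ≠ p' → 0 < B' x p') := by
  intro K
  induction K with
  | nil =>
    intro B c p o O h _ _ _ _ _ hO
    exact ⟨B, c, p, o, rfl, h, by simp, by simp, by simp, by simp, by simp, by simp, by simp,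
      by simp, by simp, hO⟩
  | cons k K ih =>
    intro B c p o O h hsort hhead hpos hhi hO1 hO2
    obtain ⟨T, hT⟩ := exists_above o
    have hk : k ≠ p := hhead k rfl
    have hkp : 0 < B k p := hhi k (by simp) hk
    have hck : 0 < c k := hpos k (by simp)
    rw [List.pairwise_cons] at hsort
    have hkK : k ∉ K := fun hm => lt_irrefl _ (hsort.1 k hm)
    have hKne : ∀ x ∈ K, x ≠ k := fun x hx e => hkK (e ▸ hx)
    have arc : ∀ x, o k < o x → 2 ≤ B k x := fun x hx => h.arcTo hk hkp hx
    have narc : ∀ x, o k < o x → B x k ≤ -2 := fun x hx => by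
      have := arc x hx; have := h.skew k x; omega
    have F1 := h.mutHi hk hkp hT
    set o1 := Function.update o k T with ho1
    have upd : ∀ x, x ≠ k → o1 x = o x := fun x hx => by simp [ho1, hx]
    have updk : o1 k = T := by simp [ho1]
    have csame : ∀ x, o k < o x → mc B c k x = c x := fun x hx =>
      mc_pn (by rintro rfl; omega) hck (by have := narc x hx; omega)
    obtain ⟨B', c', p', o', e1, e2, e3, e4, e5, e6, e7, e8, e9, e10, e11, e12⟩ :=
      ih (mutB B k) (mc B c k) k o1 (fun x => O x ∨ x = k) F1
      (hsort.2.imp_of_mem (fun {x y} hx hy hxy => by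
        rw [upd x (hKne x hx), upd y (hKne y hy)]; exact hxy))
      (fun x hx => hKne x (List.mem_of_mem_head? hx))
      (fun x hx => by rw [csame x (hsort.1 x hx)]; exact hpos x (by simp [hx]))
      (fun x hx _ => by rw [mutB_r]; have := narc x (hsort.1 x hx); omega)
      (by
        intro x hx y hy
        rw [upd y (hKne y hy)]
        rcases hx with hx | rfl
        · have h1 := hO1 x hx k (by simp)
          rw [upd x (by rintro rfl; omega)]
          exact hO1 x hx y (by simp [hy])
        · rw [updk]; exact hT y)
      (by
        rintro x (hx | rfl) hxk
        · rw [mutB_r]; have := narc x (hO1 x hx k (by simp)); omega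
        · exact absurd rfl hxk)
    refine ⟨B', c', p', o', by rw [mrun_cons, e1], e2, by simp, ?_, ?_, ?_, ?_, ?_, ?_, ?_, ?_, ?_⟩
    · intro _
      by_cases hK : K = []
      · rw [e3 hK]; simp
      · simp [e4 hK]
    · intro x hx
      simp at hx
      rw [e5 x hx.2, upd x hx.1]
    · intro g hg x hx
      simp at hx hg
      rcases hg with rfl | hg
      · rw [e5 g hkK, updk, e5 x hx.2, upd x hx.1]; exact hT x
      · exact e6 g hg x hx.2
    · intro g hg
      simp at hg
      rcases hg with rfl | hg
      · rw [e10 g (Or.inr rfl), mc_self]; omega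
      · exact e7 g hg
    · intro x hx
      simp at hx
      exact le_trans (mc_ge hx.1 hck) (e8 x hx.2)
    · intro x hx g hg hl
      simp at hx hg
      rcases hg with rfl | hg
      · have := h.arcFrom hk hl
        rw [← mc_pp hx.1 hck (by omega)]
        exact e8 x hx.2
      · have hgk := hKne g hg
        have hkg := hsort.1 g hg
        have h1 := e9 x hx.2 g hg (by rw [upd x hx.1, upd g hgk]; exact hl)
        rw [csame g hkg] at h1
        have h2 : c x ≤ mc B c k x := mc_ge hx.1 hck
        have h3 : B x g ≤ mutB B k x g := by
          have := arc g hkg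
          rcases lt_or_ge 0 (B x k) with a | a
          · rw [mutB_pp hx.1 hgk a (by omega)]; nlinarith
          · rw [mutB_np hx.1 hgk a (by omega)]
        have h4 := hpos g (by simp [hg])
        nlinarith
    · intro x hx
      rw [e10 x (Or.inl hx), csame x (hO1 x hx k (by simp))]
    · intro x y hx hy
      have hx1 := hO1 x hx k (by simp)
      have hy1 := hO1 y hy k (by simp)
      rw [e11 x y (Or.inl hx) (Or.inl hy), mutB_np (by rintro rfl; omega) (by rintro rfl; omega)]
      · have := narc x hx1; omega
      · have := arc y hy1; omega
    · intro x hx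
      exact e12 x (Or.inl hx)

theorem phase1b (A : V → Prop) : ∀ (K : List V) (B : Matrix V V ℤ) (c : V → ℤ) (p : V)
    (o : V → ℤ), FO B p o → K.Pairwise (fun x y => o x < o y) →
    (∀ k ∈ K, k ≠ p ∧ 0 < B k p ∧ c k < 0 ∧ ¬ A k) → ¬ A p →
    (∀ x y, A x → ¬ A y → o x < o y) →
    (∀ x, ¬ A x → x ∉ K → (x = p ∧ K = []) ∨ c x < 0 ∨
      ∃ e ∈ K, o e < o x ∧ c x + B e x * c e < 0) →
    ∃ B' c' p' o', mrun (B, c) K = (B', c') ∧ FO B' p' o' ∧ ¬ A p' ∧ (0 < c p → 0 < c' p') ∧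
      (∀ x, x ≠ p' → ¬ A x → c' x < 0) ∧ (∀ x, A x → c' x = c x ∧ o' x = o x) ∧
      (∀ x y, A x → ¬ A y → o' x < o' y) := by
  intro K
  induction K with
  | nil =>
    intro B c p o h _ _ hAp hA hx
    refine ⟨B, c, p, o, rfl, h, hAp, id, ?_, by simp, hA⟩
    intro x hxp hxA
    have := hx x hxA (by simp)
    simp [hxp] at this
    exact this
  | cons k K ih =>
    intro B c p o h hsort hK hAp hA hlast
    obtain ⟨T, hT⟩ := exists_above o
    obtain ⟨hk, hkp, hck, hAk⟩ := hK k (by simp)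
    rw [List.pairwise_cons] at hsort
    have hkK : k ∉ K := fun hm => lt_irrefl _ (hsort.1 k hm)
    have hKne : ∀ x ∈ K, x ≠ k := fun x hx e => hkK (e ▸ hx)
    have arc : ∀ x, o k < o x → 2 ≤ B k x := fun x hx => h.arcTo hk hkp hx
    have narc : ∀ x, o k < o x → B x k = - B k x := fun x hx => h.skew k x
    have F1 := h.mutHi hk hkp hT
    set o1 := Function.update o k T with ho1
    have upd : ∀ x, x ≠ k → o1 x = o x := fun x hx => by simp [ho1, hx]
    have updk : o1 k = T := by simp [ho1]
    have cdec : ∀ x, o k < o x → mc B c k x = c x + B k x * c k := fun x hx => by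
      have h1 := arc x hx
      have h2 := narc x hx
      rw [mc_nn (by rintro rfl; omega) hck (by omega), h2]; ring
    have cle : ∀ x, x ≠ k → mc B c k x ≤ c x := fun x hx => mc_le hx hck
    have ck1 : mc B c k k = - c k := mc_self _ _ _
    obtain ⟨B', c', p', o', e1, e2, e3, e4, e5, e6, e7⟩ :=
      ih (mutB B k) (mc B c k) k o1 F1
      (hsort.2.imp_of_mem (fun {x y} hx hy hxy => by
        rw [upd x (hKne x hx), upd y (hKne y hy)]; exact hxy))
      (by
        intro x hx
        obtain ⟨a1, a2, a3, a4⟩ := hK x (by simp [hx])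
        refine ⟨hKne x hx, ?_, ?_, a4⟩
        · have h1 := arc x (hsort.1 x hx)
          have h2 := narc x (hsort.1 x hx)
          rw [mutB_r]; omega
        · have := cle x (hKne x hx); omega)
      hAk
      (by
        intro x y hx hy
        have hxk : x ≠ k := by rintro rfl; exact hAk hx
        rw [upd x hxk]
        by_cases e : y = k
        · rw [e, updk]; exact hT x
        · rw [upd y e]; exact hA x y hx hy)
      (by
        intro x hAx hxK
        by_cases hxk : x = k
        · subst hxk
          cases K with
          | nil => exact Or.inl ⟨rfl, rfl⟩
          | cons k' K' =>
            refine Or.inr (Or.inr ⟨k', by simp, ?_, ?_⟩)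
            · rw [updk, upd k' (hKne k' (by simp))]; exact hT k'
            · have hl := hsort.1 k' (by simp)
              have h1 := arc k' hl
              have h2 := narc k' hl
              have h3 := (hK k' (by simp)).2.2.1
              rw [mutB_r, ck1, cdec k' hl, h2]
              have h4 : B x k' * c x ≤ 2 * c x := by nlinarith
              have h5 : B x k' * (c k' + B x k' * c x) ≤ 2 * (c k' + B x k' * c x) := by nlinarith
              nlinarith
        · rcases hlast x hAx (by simp [hxk, hxK]) with a | a | ⟨e, he, hl, hv⟩
          · simp at a
          · exact Or.inr (Or.inl (by have := cle x hxk; omega))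
          · simp at he
            rcases he with rfl | he
            · exact Or.inr (Or.inl (by rw [cdec x hl]; exact hv))
            · refine Or.inr (Or.inr ⟨e, he, ?_, ?_⟩)
              · rw [upd e (hKne e he), upd x hxk]; exact hl
              · have hke := hsort.1 e he
                have h1 := arc e hke
                have h2 := narc e hke
                have h3 := arc x (by omega)
                rw [mutB_np (hKne e he) hxk (by omega) (by omega)]
                obtain ⟨a1, a2, a3, a4⟩ := hK e (by simp [he])
                have h4 := h.arcTo a1 a2 hl
                have h5 := cle x hxk
                have h6 := cle e (hKne e he)
                nlinarith)
    refine ⟨B', c', p', o', by rw [mrun_cons, e1], e2, e3, ?_, e5, ?_, e7⟩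
    · intro _; exact e4 (by rw [ck1]; omega)
    · intro x hx
      have hxk : x ≠ k := by rintro rfl; exact hAk hx
      obtain ⟨a1, a2⟩ := e6 x hx
      rw [a1, a2, upd x hxk]
      refine ⟨?_, rfl⟩
      have := h.arcFrom hk (hA x k hx hAk)
      exact mc_np hxk hck (by omega)

theorem phase2 (z : V) : ∀ (K : List V) (B : Matrix V V ℤ) (c : V → ℤ) (q : V)
    (o : V → ℤ), FO B q o → z ≠ q → K.Pairwise (fun x y => o x < o y) →
    (∀ k ∈ K, k ≠ q ∧ 0 < B k q ∧ 0 < c k ∧ k ≠ z) →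
    (∀ x, x ∉ K → x ≠ z → c x < 0) →
    (∀ k ∈ K, ∀ x, x ∉ K → x ≠ z → o k < o x) →
    ∃ B' c' q' o', mrun (B, c) K = (B', c') ∧ FO B' q' o' ∧ z ≠ q' ∧ (∀ x, x ≠ z → c' x < 0) := by
  intro K
  induction K with
  | nil =>
    intro B c q o h hz _ _ hx _
    exact ⟨B, c, q, o, rfl, h, hz, fun x => hx x (by simp)⟩
  | cons k K ih =>
    intro B c q o h hz hsort hK hneg hlt
    obtain ⟨T, hT⟩ := exists_above o
    obtain ⟨hk, hkp, hck, hzk⟩ := hK k (by simp)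
    rw [List.pairwise_cons] at hsort
    have hkK : k ∉ K := fun hm => lt_irrefl _ (hsort.1 k hm)
    have hKne : ∀ x ∈ K, x ≠ k := fun x hx e => hkK (e ▸ hx)
    have F1 := h.mutHi hk hkp hT
    set o1 := Function.update o k T with ho1
    have upd : ∀ x, x ≠ k → o1 x = o x := fun x hx => by simp [ho1, hx]
    have updk : o1 k = T := by simp [ho1]
    have big : ∀ x, x ≠ k → x ≠ z → o k < o x := by
      intro x hx hxz
      by_cases hm : x ∈ K
      · exact hsort.1 x hm
      · exact hlt k (by simp) x (by simp [hx, hm]) hxz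
    have arc : ∀ x, x ≠ k → x ≠ z → B x k ≤ -2 := by
      intro x hx hxz
      have h1 := h.arcTo hk hkp (big x hx hxz)
      have h2 := h.skew k x
      omega
    have csame : ∀ x, x ≠ k → x ≠ z → mc B c k x = c x := fun x hx hxz =>
      mc_pn hx hck (by have := arc x hx hxz; omega)
    obtain ⟨B', c', q', o', e1, e2, e3, e4⟩ := ih (mutB B k) (mc B c k) k o1 F1 hzk.symm
      (hsort.2.imp_of_mem (fun {x y} hx hy hxy => by
        rw [upd x (hKne x hx), upd y (hKne y hy)]; exact hxy))
      (by
        intro x hx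
        obtain ⟨a1, a2, a3, a4⟩ := hK x (by simp [hx])
        refine ⟨hKne x hx, ?_, ?_, a4⟩
        · rw [mutB_r]; have := arc x (hKne x hx) a4; omega
        · rw [csame x (hKne x hx) a4]; exact a3)
      (by
        intro x hx hxz
        by_cases e : x = k
        · subst e; rw [mc_self]; omega
        · rw [csame x e hxz]; exact hneg x (by simp [e, hx]) hxz)
      (by
        intro g hg x hx hxz
        rw [upd g (hKne g hg)]
        by_cases e : x = k
        · subst e; rw [updk]; exact hT g
        · rw [upd x e]; exact hlt g (by simp [hg]) x (by simp [e, hx]) hxz)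
    exact ⟨B', c', q', o', by rw [mrun_cons, e1], e2, e3, e4⟩

/-- Last step. -/
theorem phase3 {B : Matrix V V ℤ} {c : V → ℤ} {q z : V} {o : V → ℤ} (h : FO B q o)
    (hc : ∀ x, x ≠ z → c x < 0) :
    ∃ x o', FO (mutB B x) x o' ∧ 0 < mc B c x x ∧ ∀ y, y ≠ x → y ≠ z → mc B c x y < 0 := by
  obtain ⟨T, hT⟩ := exists_above o
  obtain ⟨b, hb⟩ := exists_below o
  obtain ⟨x, hx⟩ := h.lo
  obtain ⟨y, hy⟩ := h.hi
  have hw := (h.wt x y hx hy).1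
  have hxy : x ≠ y := h.ne (by omega)
  have fin : ∀ w, w ≠ z → 0 < mc B c w w ∧ ∀ y, y ≠ w → y ≠ z → mc B c w y < 0 := by
    intro w hw
    have h1 := hc w hw
    refine ⟨by rw [mc_self]; omega, fun y hy hyz => ?_⟩
    have h2 : mc B c w y ≤ c y := mc_le hy h1
    have h3 := hc y hyz
    omega
  by_cases hxz : x = z
  · exact ⟨y, _, h.mutHi (h.ne hy) hy hT, fin y (by rintro rfl; exact hxy hxz)⟩
  · exact ⟨x, _, h.mutLo hx hT hb, fin x hxz⟩

end Phases

section Core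

variable {V : Type*} [DecidableEq V] [Fintype V]

/-- The state reached after the first mutation. -/
structure SO (B : Matrix V V ℤ) (p s : V) (o : V → ℤ) : Prop extends FO B p o where
  sp : s ≠ p
  smin : ∀ x, x ≠ s → o s < o x
  ps : 0 < B p s
  up : ∀ x, x ≠ p → x ≠ s → 0 < B x p

theorem FO.first {B : Matrix V V ℤ} {r : V} {o : V → ℤ} (h : FO B r o) :
    ∃ v o', SO (mutB B v) v r o' := by
  obtain ⟨T, hT⟩ := exists_above o
  obtain ⟨b, hb⟩ := exists_below o
  obtain ⟨x0, hx0⟩ := h.lo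
  have hx0r : x0 ≠ r := (h.ne hx0).symm
  obtain ⟨v, hv, hmin⟩ := Finset.exists_min_image (Finset.univ.filter fun x => x ≠ r) o
    ⟨x0, by simp [hx0r]⟩
  simp only [Finset.mem_filter, Finset.mem_univ, true_and] at hv hmin
  have hlt : ∀ x, x ≠ r → x ≠ v → o v < o x := by
    intro x hx hxv
    have h1 := hmin x hx
    have : o v ≠ o x := fun e => hxv (h.inj _ _ e).symm
    omega
  have hrv : 0 < B r v := by
    rcases h.por v hv with a | a
    · omega
    · have hw := h.wt x0 v hx0 (by omega)
      have hne : x0 ≠ v := h.ne (by omega)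
      have h1 := h.ord v x0 hv hx0r (hlt x0 hx0r hne)
      have h2 := h.skew v x0
      omega
  have F := h.mutLo hrv hT hb
  refine ⟨v, _, F, hv.symm, ?_, ?_, ?_⟩
  · intro x hx
    have : Function.update (Function.update o r b) v T r = b := by simp [hv.symm]
    rw [this]
    by_cases e : x = v
    · subst e; simp; exact lt_trans (hb x) (hT x)
    · simp [e, hx, hb]
  · rw [mutB_l]; have := h.skew r v; omega
  · intro x hx hxr
    rw [mutB_r]
    have h1 := h.ord v x hv hxr (hlt x hxr hx)
    have h2 := h.skew v x
    omega

/-- The goal configuration. -/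
def Goal (P : Matrix V V ℤ × (V → ℤ)) : Prop :=
  ∃ r' o' z, FO P.1 r' o' ∧ 0 < P.2 r' ∧ ∀ x, x ≠ r' → x ≠ z → P.2 x < 0

theorem exists_cut {B : Matrix V V ℤ} {p s : V} {o : V → ℤ} (h : SO B p s o) (c : V → ℤ) :
    ∃ t : ℤ, (∀ e, o e < t → c e < 0 → ∃ g, o g < t ∧ o e < o g ∧ 0 < c g ∧
        0 < B e g * c g + c e) ∧
      (∀ g, t ≤ o g → 0 < c g → ∃ e, t ≤ o e ∧ o e < o g ∧ c e < 0 ∧ B e g * c g ≤ - c e) := by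
  have ple : ∀ x, o x ≤ o p := fun x => by
    by_cases e : x = p
    · rw [e]
    · exact (h.top x e).le
  have smin : ∀ x, o s ≤ o x := fun x => by
    by_cases e : x = s
    · rw [e]
    · exact (h.smin x e).le
  obtain ⟨t, ⟨ht1, ht2⟩, hmax⟩ := Int.exists_greatest_of_bdd
    (P := fun t => t ≤ o p + 1 ∧ ∀ e, o e < t → c e < 0 → ∃ g, o g < t ∧ o e < o g ∧ 0 < c g ∧
        0 < B e g * c g + c e) ⟨o p + 1, fun z hz => hz.1⟩
    ⟨o s, by have := smin p; omega, fun e he => by have := smin e; omega⟩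
  refine ⟨t, ht2, ?_⟩
  intro g hg hcg
  have h1 : ¬ (o g + 1 ≤ o p + 1 ∧ ∀ e, o e < o g + 1 → c e < 0 →
      ∃ g', o g' < o g + 1 ∧ o e < o g' ∧ 0 < c g' ∧ 0 < B e g' * c g' + c e) := by
    intro hh; have := hmax _ hh; omega
  have h2 : ¬ (∀ e, o e < o g + 1 → c e < 0 →
      ∃ g', o g' < o g + 1 ∧ o e < o g' ∧ 0 < c g' ∧ 0 < B e g' * c g' + c e) :=
    fun hh => h1 ⟨by have := ple g; omega, hh⟩
  push Not at h2
  obtain ⟨e, he1, he2, he3⟩ := h2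
  have hne : o e ≠ o g := fun hh => by have := h.inj _ _ hh; subst this; omega
  refine ⟨e, ?_, by omega, he2, ?_⟩
  · by_contra hc
    obtain ⟨g', a1, a2, a3, a4⟩ := ht2 e (by omega) he2
    have := he3 g' (by omega) a2 a3
    omega
  · have := he3 g (by omega) (by omega) hcg
    omega

theorem SO.arc {B : Matrix V V ℤ} {p s : V} {o : V → ℤ} (h : SO B p s o) {x y : V} (hx : x ≠ s)
    (hl : o x < o y) : 2 ≤ B x y := by
  have hxp : x ≠ p := by
    rintro rfl
    by_cases e : y = x
    · subst e; omega
    · have := h.top y e; omega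
  exact h.toFO.arcTo hxp (h.up x hxp hx) hl

theorem caseA {B : Matrix V V ℤ} {p s : V} {o : V → ℤ} (h : SO B p s o) (c : V → ℤ)
    (hnz : ∀ x, c x ≠ 0)
    (hb : ∀ g, 0 < c g → ∃ e, o e < o g ∧ c e < 0 ∧ B e g * c g ≤ - c e) :
    ∃ w : List V, w.length ≤ Fintype.card V + 1 ∧ Goal (mrun (B, c) w) := by
  obtain ⟨T, hT⟩ := exists_above o
  obtain ⟨b, hbb⟩ := exists_below o
  have hcs : c s < 0 := by
    by_contra hh
    obtain ⟨e, he, _⟩ := hb s (by have := hnz s; omega)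
    have hes : e ≠ s := by rintro rfl; omega
    have := h.smin e hes
    omega
  have F1 := h.toFO.mutLo h.ps hT hbb
  set o1 := Function.update (Function.update o p b) s T with ho1
  have hps := h.sp.symm
  have upd : ∀ x, x ≠ s → x ≠ p → o1 x = o x := fun x hx hp => by simp [ho1, hx, hp]
  have upds : o1 s = T := by simp [ho1]
  have updp : o1 p = b := by simp [ho1, hps]
  have arc : ∀ x, x ≠ s → x ≠ p → 2 ≤ B s x := fun x hx hxp =>
    h.ord s x h.sp hxp (h.smin x hx)
  have sk : ∀ x, B x s = - B s x := fun x => h.skew s x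
  have cdec : ∀ x, x ≠ s → x ≠ p → mc B c s x = c x + B s x * c s := fun x hx hxp => by
    have h1 := arc x hx hxp
    have h2 := sk x
    rw [mc_nn hx hcs (by omega), h2]; ring
  have cle : ∀ x, x ≠ s → mc B c s x ≤ c x := fun x hx => mc_le hx hcs
  obtain ⟨K, k1, k2, k3⟩ := exists_sorted o h.inj
    (Finset.univ.filter fun x => x ≠ p ∧ x ≠ s ∧ c x < 0)
  simp only [Finset.mem_filter, Finset.mem_univ, true_and] at k1
  obtain ⟨B', c', p', o', e1, e2, e3, e4, e5, e6, e7⟩ := phase1b (fun x => x = p) K (mutB B s)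
    (mc B c s) s o1 F1
    (k2.imp_of_mem (fun {x y} hx hy hxy => by
        rw [k1] at hx hy
        rw [upd x hx.2.1 hx.1, upd y hy.2.1 hy.1]; exact hxy))
    (by
      intro k hk
      rw [k1] at hk
      obtain ⟨a1, a2, a3⟩ := hk
      refine ⟨a2, ?_, ?_, a1⟩
      · rw [mutB_r]; have := arc k a2 a1; have := sk k; omega
      · have := cle k a2; omega)
    h.sp
    (by
      rintro x y rfl hy
      rw [updp]
      by_cases e : y = s
      · rw [e, upds]; exact lt_trans (hbb s) (hT s)
      · rw [upd y e hy]; exact hbb y)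
    (by
      intro x hxp hxK
      by_cases hxs : x = s
      · subst hxs
        cases K with
        | nil => exact Or.inl ⟨rfl, rfl⟩
        | cons k' K' =>
          refine Or.inr (Or.inr ⟨k', by simp, ?_, ?_⟩)
          all_goals obtain ⟨a1, a2, a3⟩ := (k1 k').1 (by simp)
          · rw [upds, upd k' a2 a1]; exact hT k'
          · have h1 := arc k' a2 a1
            have h2 := sk k'
            rw [mutB_r, mc_self, cdec k' a2 a1, h2]
            have h4 : B x k' * c x ≤ 2 * c x := by nlinarith
            have h5 : B x k' * (c k' + B x k' * c x) ≤ 2 * (c k' + B x k' * c x) := by nlinarith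
            nlinarith
      · by_cases hcx : c x < 0
        · exact absurd ((k1 x).2 ⟨hxp, hxs, hcx⟩) hxK
        · have hcx' : 0 < c x := by have := hnz x; omega
          obtain ⟨e, b1, b2, b3⟩ := hb x hcx'
          refine Or.inr ?_
          by_cases hes : e = s
          · subst hes
            left
            rw [cdec x hxs hxp]
            have h1 := arc x hxs hxp
            have h2 : 2 * c x ≤ B e x * c x := by nlinarith
            have h3 : B e x * c e ≤ 2 * c e := by nlinarith
            linarith
          · right
            have hep : e ≠ p := by rintro rfl; have := h.top x hxp; omega
            refine ⟨e, (k1 e).2 ⟨hep, hes, b2⟩, ?_, ?_⟩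
            · rw [upd e hes hep, upd x hxs hxp]; exact b1
            · have h1 := arc e hes hep
              have h1' := sk e
              have h2 := arc x hxs hxp
              rw [mutB_np hes hxs (by omega) (by omega)]
              have h3 := h.arc hes b1
              have h4 := cle x hxs
              have h5 := cle e hes
              have h6 : 2 * c x ≤ B e x * c x := by nlinarith
              have h7 : B e x * mc B c s e ≤ 2 * mc B c s e := by nlinarith
              linarith)
  refine ⟨s :: K, ?_, ?_⟩
  · have := Finset.card_le_univ (Finset.univ.filter fun x => x ≠ p ∧ x ≠ s ∧ c x < 0)
    simp only [List.length_cons, k3]; omega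
  · rw [mrun_cons, e1]
    exact ⟨p', o', p, e2, e4 (by rw [mc_self]; omega), e5⟩

theorem caseB {B : Matrix V V ℤ} {p s : V} {o : V → ℤ} (h : SO B p s o) (c : V → ℤ)
    (hnz : ∀ x, c x ≠ 0) (t : ℤ) (hst : o s < t)
    (hF : ∀ e, o e < t → c e < 0 → ∃ g, o g < t ∧ o e < o g ∧ 0 < c g ∧
        0 < B e g * c g + c e)
    (hb : ∀ g, t ≤ o g → 0 < c g → ∃ e, t ≤ o e ∧ o e < o g ∧ c e < 0 ∧ B e g * c g ≤ - c e) :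
    ∃ w : List V, w.length ≤ Fintype.card V + 1 ∧ Goal (mrun (B, c) w) := by
  have smin : ∀ x, o s ≤ o x := fun x => by
    by_cases e : x = s
    · rw [e]
    · exact (h.smin x e).le
  obtain ⟨K1, k1, k2, k3⟩ := exists_sorted o h.inj
    (Finset.univ.filter fun x => o x < t ∧ x ≠ s ∧ 0 < c x)
  simp only [Finset.mem_filter, Finset.mem_univ, true_and] at k1
  by_cases hhead : K1.head? = some p
  · refine ⟨[], by simp, p, o, s, h.toFO, ?_, ?_⟩
    · exact ((k1 p).1 (List.mem_of_mem_head? hhead)).2.2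
    · intro x hxp hxs
      by_contra hcx
      change ¬ c x < 0 at hcx
      have hcx' : 0 < c x := by have := hnz x; omega
      have hpt := ((k1 p).1 (List.mem_of_mem_head? hhead)).1
      have hl := h.top x hxp
      have hxm := (k1 x).2 ⟨by omega, hxs, hcx'⟩
      cases K1 with
      | nil => simp at hxm
      | cons a l =>
        simp at hhead
        subst hhead
        simp [hxp] at hxm
        have := (List.pairwise_cons.1 k2).1 x hxm
        omega
  obtain ⟨K2, l1, l2, l3⟩ := exists_sorted o h.inj
    (Finset.univ.filter fun x => t ≤ o x ∧ x ≠ p ∧ c x < 0)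
  simp only [Finset.mem_filter, Finset.mem_univ, true_and] at l1
  obtain ⟨K3, m1, m2, m3⟩ := exists_sorted o h.inj
    (Finset.univ.filter fun x => o x < t ∧ ¬ (x ≠ s ∧ 0 < c x) ∧ x ≠ s)
  simp only [Finset.mem_filter, Finset.mem_univ, true_and] at m1
  -- phase 1a
  obtain ⟨B1, c1, p1, o1, e1, F1, e3, e4, e5, e6, e7, e8, e9, e10, e11, e12⟩ :=
    phase1a K1 B c p o (fun x => t ≤ o x) h.toFO k2
      (fun k hk e => hhead (by rw [hk, e]))
      (fun k hk => ((k1 k).1 hk).2.2)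
      (fun k hk hkp => h.up k hkp ((k1 k).1 hk).2.1)
      (fun x hx k hk => by have := ((k1 k).1 hk).1; omega)
      (fun x hx hxp => h.up x hxp (by rintro rfl; omega))
  let A : V → Prop := fun x => o x < t ∧ ¬ (x ≠ s ∧ 0 < c x)
  have AK1 : ∀ x, A x → x ∉ K1 := fun x hx hm => hx.2 ((k1 x).1 hm).2
  have OK1 : ∀ x, t ≤ o x → x ∉ K1 := fun x hx hm => by have := ((k1 x).1 hm).1; omega
  have nA : ∀ x, ¬ A x → x ∈ K1 ∨ t ≤ o x := by
    intro x hx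
    by_cases hl : o x < t
    · left
      rw [k1]
      refine ⟨hl, ?_⟩
      by_contra hc
      exact hx ⟨hl, hc⟩
    · right; omega
  have K1A : ∀ x, x ∈ K1 → ¬ A x := fun x hx ha => AK1 x ha hx
  have OA : ∀ x, t ≤ o x → ¬ A x := fun x hx ha => by have := ha.1; omega
  have sA : A s := ⟨hst, by simp⟩
  have p1A : ¬ A p1 := by
    by_cases hK : K1 = []
    · rw [e3 hK]
      rintro ⟨a1, a2⟩
      have hcp : c p < 0 := by
        have := hnz p
        have : ¬ 0 < c p := fun hh => a2 ⟨h.sp.symm, hh⟩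
        omega
      obtain ⟨g, g1, g2, g3, g4⟩ := hF p a1 hcp
      by_cases e : g = p
      · subst e; omega
      · have := h.top g e; omega
    · exact K1A _ (e4 hK)
  have ordA : ∀ x y, A x → ¬ A y → o1 x < o1 y := by
    intro x y hx hy
    rcases nA y hy with a | a
    · exact e6 y a x (AK1 x hx)
    · rw [e5 x (AK1 x hx), e5 y (OK1 y a)]
      have := hx.1
      omega
  have posA : ∀ x, A x → 0 < c1 x := by
    intro x hx
    by_cases hcx : c x < 0
    · obtain ⟨g, g1, g2, g3, g4⟩ := hF x hx.1 hcx
      have hgs : g ≠ s := by rintro rfl; have := smin x; omega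
      have := e9 x (AK1 x hx) g ((k1 g).2 ⟨g1, hgs, g3⟩) g2
      omega
    · have := e8 x (AK1 x hx)
      have := hnz x
      omega
  -- phase 1b
  obtain ⟨B2, c2, p2, o2, f1, F2, f3, f4, f5, f6, f7⟩ := phase1b A K2 B1 c1 p1 o1 F1
    (l2.imp_of_mem (fun {x y} hx hy hxy => by
        rw [l1] at hx hy
        rw [e5 x (OK1 x hx.1), e5 y (OK1 y hy.1)]; exact hxy))
    (by
      intro k hk
      obtain ⟨a1, a2, a3⟩ := (l1 k).1 hk
      have hkp1 : k ≠ p1 := by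
        rintro rfl
        by_cases hK : K1 = []
        · exact a2 (e3 hK)
        · exact OK1 k a1 (e4 hK)
      exact ⟨hkp1, e12 k a1 hkp1, by rw [e10 k a1]; exact a3, OA k a1⟩)
    p1A ordA
    (by
      intro x hx hxK
      right
      rcases nA x hx with a | a
      · exact Or.inl (e7 x a)
      · rw [e10 x a]
        by_cases hcx : c x < 0
        · exact Or.inl hcx
        · right
          have hcx' : 0 < c x := by have := hnz x; omega
          obtain ⟨e, b1, b2, b3, b4⟩ := hb x a hcx'
          have hep : e ≠ p := by
            rintro rfl
            by_cases hh : x = e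
            · subst hh; omega
            · have := h.top x hh; omega
          have hes : e ≠ s := by rintro rfl; omega
          refine ⟨e, (l1 e).2 ⟨b1, hep, b3⟩, ?_, ?_⟩
          · rw [e5 e (OK1 e b1), e5 x (OK1 x a)]; exact b2
          · rw [e10 e b1, e11 e x b1 a]
            have h3 := h.arc hes b2
            have h6 : 2 * c x ≤ B e x * c x := by nlinarith
            have h7 : B e x * c e ≤ 2 * c e := by nlinarith
            linarith)
  -- phase 2
  have A12 : ∀ x, A x → o2 x = o x := fun x hx => by
    rw [(f6 x hx).2, e5 x (AK1 x hx)]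
  have posA2 : ∀ x, A x → 0 < c2 x := fun x hx => by rw [(f6 x hx).1]; exact posA x hx
  have smin2 : ∀ x, x ≠ s → o2 s < o2 x := by
    intro x hx
    by_cases ha : A x
    · rw [A12 x ha, A12 s sA]; exact h.smin x hx
    · exact f7 s x sA ha
  have sp2 : s ≠ p2 := fun e => f3 (e ▸ sA)
  have ps2 : 0 < B2 p2 s := by
    rcases F2.por s sp2 with a | a
    · omega
    · obtain ⟨y, hy⟩ := F2.lo
      have hw := F2.wt y s hy (by omega)
      have hys : y ≠ s := F2.ne (by omega)
      have hyp : y ≠ p2 := (F2.ne hy).symm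
      have h1 := F2.ord s y sp2 hyp (smin2 y hys)
      have h2 := F2.skew s y
      omega
  have hcs := posA2 s sA
  obtain ⟨T, hT⟩ := exists_above o2
  obtain ⟨b, hbb⟩ := exists_below o2
  have F3 := F2.mutLo ps2 hT hbb
  set o3 := Function.update (Function.update o2 p2 b) s T with ho3
  have upd : ∀ x, x ≠ s → x ≠ p2 → o3 x = o2 x := fun x hx hp => by simp [ho3, hx, hp]
  have upds : o3 s = T := by simp [ho3]
  have arc : ∀ x, x ≠ s → x ≠ p2 → B2 x s ≤ -2 := fun x hx hxp => by
    have h1 := F2.ord s x sp2 hxp (smin2 x hx)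
    have h2 := F2.skew s x
    omega
  have csame : ∀ x, x ≠ s → x ≠ p2 → mc B2 c2 s x = c2 x := fun x hx hxp =>
    mc_pn hx hcs (by have := arc x hx hxp; omega)
  have K3A : ∀ x, x ∈ K3 ↔ A x ∧ x ≠ s := fun x => by
    rw [m1]; exact and_assoc.symm
  have Ap2 : ∀ x, A x → x ≠ p2 := fun x hx e => f3 (e ▸ hx)
  obtain ⟨B4, c4, q, o4, g1, F4, g3, g4⟩ := phase2 p2 K3 (mutB B2 s) (mc B2 c2 s) s o3 F3 sp2.symm
    (m2.imp_of_mem (fun {x y} hx hy hxy => by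
        rw [K3A] at hx hy
        rw [upd x hx.2 (Ap2 x hx.1), upd y hy.2 (Ap2 y hy.1), A12 x hx.1, A12 y hy.1]; exact hxy))
    (by
      intro k hk
      obtain ⟨a1, a2⟩ := (K3A k).1 hk
      have a3 := Ap2 k a1
      refine ⟨a2, ?_, ?_, a3⟩
      · rw [mutB_r]; have := arc k a2 a3; omega
      · rw [csame k a2 a3]; exact posA2 k a1)
    (by
      intro x hx hxp
      by_cases hxs : x = s
      · subst hxs; rw [mc_self]; omega
      · rw [csame x hxs hxp]
        exact f5 x hxp fun ha => hx ((K3A x).2 ⟨ha, hxs⟩))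
    (by
      intro k hk x hx hxp
      obtain ⟨a1, a2⟩ := (K3A k).1 hk
      have a3 := Ap2 k a1
      rw [upd k a2 a3]
      by_cases hxs : x = s
      · subst hxs; rw [upds]; exact hT k
      · rw [upd x hxs hxp]
        exact f7 k x a1 fun ha => hx ((K3A x).2 ⟨ha, hxs⟩))
  obtain ⟨y, o5, F5, y1, y2⟩ := phase3 F4 g4
  refine ⟨K1 ++ (K2 ++ (s :: (K3 ++ [y]))), ?_, ?_⟩
  · have hnd : (K1 ++ (K2 ++ (s :: K3))).Nodup := by
      have nd : ∀ l : List V, l.Pairwise (fun x y => o x < o y) → l.Nodup := fun l hl =>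
        hl.imp fun {a b} hab e => by subst e; omega
      rw [List.nodup_append, List.nodup_append, List.nodup_cons]
      refine ⟨nd _ k2, ⟨nd _ l2, ⟨fun hh => ((K3A s).1 hh).2 rfl, nd _ m2⟩, ?_⟩, ?_⟩
      · rintro x hx y hy rfl
        have hxo := ((l1 x).1 hx).1
        simp at hy
        rcases hy with rfl | hy
        · omega
        · exact OA x hxo ((K3A x).1 hy).1
      · rintro x hx y hy rfl
        simp at hy
        rcases hy with hy | rfl | hy
        · exact OK1 x ((l1 x).1 hy).1 hx
        · exact K1A x hx sA
        · exact K1A x hx ((K3A x).1 hy).1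
    have := hnd.length_le_card
    simp at this ⊢
    omega
  · rw [mrun_append, e1, mrun_append, f1, mrun_cons, mrun_append, g1]
    exact ⟨y, o5, p2, F5, y1, y2⟩

theorem core {B : Matrix V V ℤ} {r : V} {o : V → ℤ} (h : FO B r o) (c : V → ℤ)
    (hnz : ∀ w x, (mrun (B, c) w).2 x ≠ 0) :
    ∃ w : List V, w.length ≤ Fintype.card V + 2 ∧ Goal (mrun (B, c) w) := by
  obtain ⟨v, o1, S⟩ := h.first
  have hnz1 : ∀ x, mc B c v x ≠ 0 := hnz [v]
  obtain ⟨t, h1, h2⟩ := exists_cut S (mc B c v)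
  have : ∃ w : List V, w.length ≤ Fintype.card V + 1 ∧ Goal (mrun (mutB B v, mc B c v) w) := by
    rcases lt_or_ge (o1 r) t with a | a
    · exact caseB S _ hnz1 t a h1 h2
    · refine caseA S _ hnz1 fun g hg => ?_
      have : t ≤ o1 g := by
        by_cases e : g = r
        · rw [e]; exact a
        · have := S.smin g e; omega
      obtain ⟨e, _, he⟩ := h2 g this hg
      exact ⟨e, he⟩
  obtain ⟨w, hw, hg⟩ := this
  exact ⟨v :: w, by simp; omega, by rw [mrun_cons]; exact hg⟩

end Core

section Reduce

variable {V : Type*} [DecidableEq V] {m : ℕ}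

/-- Row sums of the `C`-matrix. -/
def rsum (C : Matrix V (Fin m) ℤ) : V → ℤ := fun x => ∑ t, C x t

theorem QGreen.pos {C : Matrix V (Fin m) ℤ} {x : V} (h : QGreen C x) : 0 < rsum C x := by
  refine lt_of_le_of_ne (Finset.sum_nonneg fun t _ => h.1 t) fun e => h.2 ?_
  have := (Finset.sum_eq_zero_iff_of_nonneg (fun t _ => h.1 t)).1 e.symm
  funext t
  exact this t (Finset.mem_univ _)

theorem QRed.neg {C : Matrix V (Fin m) ℤ} {x : V} (h : QRed C x) : rsum C x < 0 := by
  refine lt_of_le_of_ne (Finset.sum_nonpos fun t _ => h.1 t) fun e => h.2 ?_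
  have := (Finset.sum_eq_zero_iff_of_nonpos (fun t _ => h.1 t)).1 e
  funext t
  exact this t (Finset.mem_univ _)

theorem rsum_max (C : Matrix V (Fin m) ℤ) (k : V) (b : ℤ) (h : QRed C k ∨ QGreen C k) :
    ∑ t, max (b * C k t) 0 = max (b * rsum C k) 0 := by
  have key : (∀ t, 0 ≤ b * C k t) ∨ (∀ t, b * C k t ≤ 0) := by
    rcases h with h | h <;> rcases le_total 0 b with hb | hb
    · exact Or.inr fun t => mul_nonpos_of_nonneg_of_nonpos hb (h.1 t)
    · exact Or.inl fun t => mul_nonneg_of_nonpos_of_nonpos hb (h.1 t)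
    · exact Or.inl fun t => mul_nonneg hb (h.1 t)
    · exact Or.inr fun t => mul_nonpos_of_nonpos_of_nonneg hb (h.1 t)
  have e : b * rsum C k = ∑ t, b * C k t := by rw [rsum, Finset.mul_sum]
  rw [e]
  rcases key with a | a
  · rw [max_eq_left (Finset.sum_nonneg fun t _ => a t)]
    exact Finset.sum_congr rfl fun t _ => max_eq_left (a t)
  · rw [max_eq_right (Finset.sum_nonpos fun t _ => a t)]
    exact Finset.sum_eq_zero fun t _ => max_eq_right (a t)

theorem rsum_mut (B : Matrix V V ℤ) (C : Matrix V (Fin m) ℤ) (k : V)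
    (h : QRed C k ∨ QGreen C k) : mc B (rsum C) k = rsum (mutC B C k) := by
  funext x
  by_cases hx : x = k
  · subst hx
    simp [mc, mutC, rsum]
  · simp only [mc, hx, if_false]
    rw [← rsum_max C k (B x k) h, Finset.mul_sum]
    simp [mutC, rsum, hx, Finset.sum_add_distrib]

theorem mrun_rsum : ∀ (w : List V) (B : Matrix V V ℤ) (C : Matrix V (Fin m) ℤ), SSC (B, C) →
    mrun (B, rsum C) w = ((mutSeqPair (B, C) w).1, rsum (mutSeqPair (B, C) w).2) := by
  intro w
  induction w with
  | nil => intro B C _; rfl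
  | cons k w ih =>
    intro B C h
    rw [mrun_cons, rsum_mut B C k (h [] k)]
    exact ih (mutB B k) (mutC B C k) fun u i => h (k :: u) i

end Reduce

/-- Corollary `cor-tsc-fork-mutate-green-por`. -/
theorem ssc_fork_mutate_green_por {n m : ℕ}
    (B : Matrix (Fin n) (Fin n) ℤ) (C : Matrix (Fin n) (Fin m) ℤ)
    (hskew : ∀ i j, B j i = -B i j)
    (r : Fin n) (hfork : QFork B r)
    (hssc : SSC (B, C)) :
    ∃ w : List (Fin n), w.length ≤ n + 2 ∧
      ∃ r' : Fin n, QFork (mutSeqPair (B, C) w).1 r' ∧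
        QGreen (mutSeqPair (B, C) w).2 r' ∧
        {i : Fin n | QGreen (mutSeqPair (B, C) w).2 i}.ncard ≤ 2 ∧
        n - 2 ≤ {i : Fin n | QRed (mutSeqPair (B, C) w).2 i}.ncard := by
  obtain ⟨o, F⟩ := QFork.exists_FO hskew hfork
  obtain ⟨w, hw, r', o', z, F', hr, hx⟩ := core F (rsum C) (by
    intro w x
    rw [mrun_rsum w B C hssc]
    rcases hssc w x with h | h
    · exact ne_of_lt h.neg
    · exact ne_of_gt h.pos)
  rw [mrun_rsum w B C hssc] at F' hr hx
  refine ⟨w, by simpa using hw, r', F'.qfork, ?_, ?_⟩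
  · rcases hssc w r' with h | h
    · have := h.neg
      simp only at hr
      omega
    · exact h
  set C' := (mutSeqPair (B, C) w).2 with hC'
  have hsub : {i : Fin n | QGreen C' i} ⊆ {r', z} := by
    intro i hi
    by_contra hc
    simp at hc
    have h1 := hx i hc.1 hc.2
    have h2 := QGreen.pos hi
    simp only at h1
    omega
  have hg : {i : Fin n | QGreen C' i}.ncard ≤ 2 :=
    le_trans (Set.ncard_le_ncard hsub (Set.toFinite _)) (le_trans (Set.ncard_insert_le _ _) (by simp))
  refine ⟨hg, ?_⟩
  have huni : (Set.univ : Set (Fin n)) ⊆ {i | QGreen C' i} ∪ {i | QRed C' i} := by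
    intro i _
    exact (hssc w i).symm
  have h1 := Set.ncard_le_ncard huni (Set.toFinite _)
  have h2 := Set.ncard_union_le {i : Fin n | QGreen C' i} {i | QRed C' i}
  rw [Set.ncard_univ, Nat.card_fin] at h1
  omega
end

section
/- Let Q = [B | C] be an ice quiver in which either every mutable vertex is red or every mutable vertex is green. Then for every mutable vertex v, writing [B^{[v]} | C^{[v]}] = μ_v([B | C]) with c-vectors c_i^{[v]}: (1) every mutable vertex of μ_v(Q) is red or green; (2) if every entry of b^{[v]}_{vj}·c^{[v]}_j is ≥ 0 and b^{[v]}_{vj} ≠ 0 for some mutable j ≠ v, then sgn(c^{[v]}_j) = sgn(c^{[v]}_v) or sgn(c^{[v]}_j)·c^{[v]}_j ≥ sgn(c^{[v]}_v)·c^{[v]}_v entrywise; (3) if every entry of b^{[v]}_{vj}·c^{[v]}_j is ≤ 0 for some mutable j ≠ v, then sgn(c^{[v]}_j) = -sgn(c^{[v]}_v); (4) if every entry of b^{[v]}_{ij}·c^{[v]}_j is ≥ 0 for distinct mutable vertices i, j both different from v, then sgn(c^{[v]}_i) = sgn(c^{[v]}_j). -/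
open Matrix

theorem mutC_green_entry {b x y : ℤ} (hx : 0 ≤ x) :
    y ≤ y + b.sign * max (b * x) 0 ∧ (0 < b → y + x ≤ y + b.sign * max (b * x) 0) := by
  rcases lt_trichotomy b 0 with h | h | h
  · rw [Int.sign_eq_neg_one_of_neg h, max_eq_right (by nlinarith)]
    exact ⟨by omega, fun h' => by omega⟩
  · subst h; simp
  · rw [Int.sign_eq_one_of_pos h, max_eq_left (by positivity)]
    exact ⟨by nlinarith, fun _ => by nlinarith⟩

theorem mutC_red_entry {b x y : ℤ} (hx : x ≤ 0) :
    y + b.sign * max (b * x) 0 ≤ y ∧ (b < 0 → y + b.sign * max (b * x) 0 ≤ y + x) := by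
  rcases lt_trichotomy b 0 with h | h | h
  · rw [Int.sign_eq_neg_one_of_neg h, max_eq_left (by nlinarith)]
    exact ⟨by nlinarith, fun _ => by nlinarith⟩
  · subst h; simp
  · rw [Int.sign_eq_one_of_pos h, max_eq_right (by nlinarith)]
    exact ⟨by omega, fun h' => by omega⟩

/-- Lemma `lem-framings-sign-coherent`. -/
theorem framings_sign_coherent {n m : ℕ}
    (B : Matrix (Fin n) (Fin n) ℤ) (C : Matrix (Fin n) (Fin m) ℤ)
    (hskew : ∀ i j, B j i = -B i j)
    (hmono : (∀ i, QRed C i) ∨ (∀ i, QGreen C i))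
    (v : Fin n) :
    (∀ i, QRed (mutPair (B, C) v).2 i ∨ QGreen (mutPair (B, C) v).2 i) ∧
    (∀ j, j ≠ v → (∀ t, 0 ≤ (mutPair (B, C) v).1 v j * (mutPair (B, C) v).2 j t) →
      (mutPair (B, C) v).1 v j ≠ 0 →
      (SameSignQ (mutPair (B, C) v).2 j v ∨
        ∀ t, |(mutPair (B, C) v).2 v t| ≤ |(mutPair (B, C) v).2 j t|)) ∧
    (∀ j, j ≠ v → (∀ t, (mutPair (B, C) v).1 v j * (mutPair (B, C) v).2 j t ≤ 0) →
      OppSignQ (mutPair (B, C) v).2 j v) ∧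
    (∀ i j, i ≠ j → i ≠ v → j ≠ v →
      (∀ t, 0 ≤ (mutPair (B, C) v).1 i j * (mutPair (B, C) v).2 j t) →
      SameSignQ (mutPair (B, C) v).2 i j) := by
  have hBv : ∀ j, (mutPair (B, C) v).1 v j = B j v := by
    intro j
    simp [mutPair, mutB, hskew v j]
  have hCv : ∀ t, (mutPair (B, C) v).2 v t = -C v t := by
    intro t
    simp [mutPair, mutC]
  have hCj : ∀ j, j ≠ v → ∀ t, (mutPair (B, C) v).2 j t =
      C j t + (B j v).sign * max (B j v * C v t) 0 := by
    intro j hj t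
    simp [mutPair, mutC, hj]
  generalize (mutPair (B, C) v).1 = B' at *
  generalize (mutPair (B, C) v).2 = C' at *
  rcases hmono with h | h
  · have hv : QGreen C' v := by
      refine ⟨fun t => by rw [hCv]; have := (h v).1 t; omega, fun h0 => (h v).2 ?_⟩
      funext t
      have h1 := congrFun h0 t
      rw [hCv] at h1
      simpa using h1
    have hj : ∀ j, j ≠ v → QRed C' j := by
      intro j hj
      have key : ∀ t, C' j t ≤ C j t := fun t => by
        rw [hCj j hj]; exact (mutC_red_entry ((h v).1 t)).1
      refine ⟨fun t => (key t).trans ((h j).1 t), fun h0 => (h j).2 ?_⟩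
      funext t
      have h1 := congrFun h0 t
      have h2 := key t
      have h3 := (h j).1 t
      simp only [Pi.zero_apply] at h1 ⊢
      omega
    refine ⟨fun i => ?_, fun j hjv hs hb => Or.inr fun t => ?_,
      fun j hjv _ => Or.inr ⟨hj j hjv, hv⟩, fun i j _ hi hjv _ => Or.inr ⟨hj i hi, hj j hjv⟩⟩
    · by_cases hi : i = v
      · subst hi; exact Or.inr hv
      · exact Or.inl (hj i hi)
    · have hneg : B j v < 0 := by
        obtain ⟨s, hs0⟩ := Function.ne_iff.mp (hj j hjv).2
        have h1 := lt_of_le_of_ne ((hj j hjv).1 s) hs0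
        have h2 := hs s
        rw [hBv] at h2 hb
        by_contra hc
        have : 0 < B j v := by omega
        nlinarith
      have h1 := (mutC_red_entry (b := B j v) (y := C j t) ((h v).1 t)).2 hneg
      rw [← hCj j hjv] at h1
      rw [abs_of_nonneg (hv.1 t), abs_of_nonpos ((hj j hjv).1 t), hCv]
      have := (h j).1 t
      omega
  · have hv : QRed C' v := by
      refine ⟨fun t => by rw [hCv]; have := (h v).1 t; omega, fun h0 => (h v).2 ?_⟩
      funext t
      have h1 := congrFun h0 t
      rw [hCv] at h1
      simpa using h1
    have hj : ∀ j, j ≠ v → QGreen C' j := by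
      intro j hj
      have key : ∀ t, C j t ≤ C' j t := fun t => by
        rw [hCj j hj]; exact (mutC_green_entry ((h v).1 t)).1
      refine ⟨fun t => ((h j).1 t).trans (key t), fun h0 => (h j).2 ?_⟩
      funext t
      have h1 := congrFun h0 t
      have h2 := key t
      have h3 := (h j).1 t
      simp only [Pi.zero_apply] at h1 ⊢
      omega
    refine ⟨fun i => ?_, fun j hjv hs hb => Or.inr fun t => ?_,
      fun j hjv _ => Or.inl ⟨hj j hjv, hv⟩, fun i j _ hi hjv _ => Or.inl ⟨hj i hi, hj j hjv⟩⟩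
    · by_cases hi : i = v
      · subst hi; exact Or.inl hv
      · exact Or.inr (hj i hi)
    · have hpos : 0 < B j v := by
        obtain ⟨s, hs0⟩ := Function.ne_iff.mp (hj j hjv).2
        have h1 := lt_of_le_of_ne ((hj j hjv).1 s) (Ne.symm hs0)
        have h2 := hs s
        rw [hBv] at h2 hb
        by_contra hc
        have : B j v < 0 := by omega
        nlinarith
      have h1 := (mutC_green_entry (b := B j v) (y := C j t) ((h v).1 t)).2 hpos
      rw [← hCj j hjv] at h1
      rw [abs_of_nonpos (hv.1 t), abs_of_nonneg ((hj j hjv).1 t), hCv]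
      have := (h j).1 t
      omega
end
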